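/- arXiv:1604.03795 — 3 statements merged into one kernel-verified Lean document; each statement's English description precedes it below -/
import Mathlib

section
/- Let p(z,w) = −(4 + z + 1/z + w + 1/w) be the characteristic polynomial of the toroidal dimer model on the overlaid bipartite graph of the infinite square weave 𝒲 (the overlaid graph of the square grid and its planar dual). Then 2π · m(p) = 8 · L(χ₋₄, 2), where m is the two-variable Mahler measure; equivalently, ∫₀^{2π} ∫₀^{2π} log (4 + 2 cos s + 2 cos t) ds dt = 16π · L(χ₋₄, 2). (This is the paper's computation 2π·m(p(z,w)) = 2·v_oct for the square weave, since v_oct = 4·L(χ₋₄,2).) -/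
open Real

/-- Jensen's formula for `z + z⁻¹ + (r + r⁻¹)` with `r = exp x`. -/
theorem integral_log_two_mul_cosh_add_two_mul_cos {x : ℝ} (hx : 0 ≤ x) :
    ∫ t in (0:ℝ)..(2 * π), log (2 * cosh x + 2 * cos t) = 2 * π * x := by
  have hpt : ∀ t : ℝ, log (2 * cosh x + 2 * cos t)
      = 2 * log ‖circleMap 0 1 t + (exp x : ℝ)‖ - x := by
    intro t
    have hnorm : ‖circleMap 0 1 t + (exp x : ℝ)‖ ^ 2 = exp x * (2 * cosh x + 2 * cos t) := by
      rw [← Complex.normSq_eq_norm_sq, Complex.normSq_apply]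
      simp only [circleMap, Complex.ofReal_one, one_mul, zero_add, Complex.add_re, Complex.add_im,
        Complex.exp_ofReal_mul_I_re, Complex.exp_ofReal_mul_I_im, Complex.ofReal_re,
        Complex.ofReal_im, add_zero, cosh_eq, exp_neg]
      have := exp_ne_zero x
      field_simp
      linear_combination sin_sq_add_cos_sq t
    rcases eq_or_ne (2 * cosh x + 2 * cos t) 0 with h | h
    · have hx0 : x = 0 := by
        by_contra hne
        linarith [one_lt_cosh.2 hne, neg_one_le_cos t]
      rw [h, mul_zero, sq_eq_zero_iff] at hnorm
      rw [h, hnorm, log_zero, hx0]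
      simp
    · have := congrArg log hnorm
      rw [log_pow, log_mul (exp_ne_zero x) h, log_exp] at this
      rw [Nat.cast_ofNat] at this
      linarith
  have hintegrable : CircleIntegrable (fun z : ℂ => log ‖z + (exp x : ℝ)‖) 0 1 :=
    MeromorphicOn.circleIntegrable_log_norm (fun z _ ↦ by fun_prop)
  have havg := circleAverage_log_norm_add_const_eq_posLog (a := ((exp x : ℝ) : ℂ))
  rw [Complex.norm_real, norm_of_nonneg (exp_pos x).le, posLog_eq_log, log_exp,
    circleAverage, smul_eq_mul, inv_mul_eq_iff_eq_mul₀ (by positivity)] at havg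
  · simp_rw [hpt]
    rw [intervalIntegral.integral_sub (hintegrable.const_mul 2) (by simp),
      intervalIntegral.integral_const_mul, havg, intervalIntegral.integral_const, smul_eq_mul]
    ring
  · rw [abs_of_pos (exp_pos x)]
    exact one_le_exp hx

theorem integral_log_four_add_two_mul_cos (s : ℝ) :
    ∫ t in (0:ℝ)..(2 * π), log (4 + 2 * cos s + 2 * cos t)
      = 4 * π * arsinh |cos (s / 2)| := by
  have hcosh : 4 + 2 * cos s = 2 * cosh (2 * arsinh |cos (s / 2)|) := by
    rw [cosh_two_mul, cosh_sq, sinh_arsinh, sq_abs, cos_sq, mul_div_cancel₀ s two_ne_zero]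
    ring
  rw [hcosh, integral_log_two_mul_cosh_add_two_mul_cos]
  · ring
  · have := arsinh_nonneg_iff.2 (abs_nonneg (cos (s / 2)))
    positivity

theorem integral_arsinh_abs_cos_half :
    ∫ s in (0:ℝ)..(2 * π), arsinh |cos (s / 2)|
      = 4 * ∫ u in (0:ℝ)..(π / 2), arsinh (sin u) := by
  have hcont : Continuous fun u : ℝ => arsinh |cos u| := continuous_cos.abs.arsinh
  have hfirst : ∫ u in (0:ℝ)..(π / 2), arsinh |cos u| = ∫ u in (0:ℝ)..(π / 2), arsinh (sin u) := by
    have := intervalIntegral.integral_comp_sub_left (a := 0) (b := π / 2)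
      (fun u => arsinh |cos u|) (π / 2)
    simp only [sub_self, sub_zero, cos_pi_div_two_sub] at this
    rw [← this]
    refine intervalIntegral.integral_congr fun u hu => ?_
    rw [Set.uIcc_of_le (by positivity)] at hu
    have : 0 ≤ sin u := sin_nonneg_of_nonneg_of_le_pi hu.1 (by linarith [hu.2, pi_pos])
    simp only [abs_of_nonneg this]
  have hsecond : ∫ u in (π / 2)..π, arsinh |cos u| = ∫ u in (0:ℝ)..(π / 2), arsinh |cos u| := by
    have := intervalIntegral.integral_comp_sub_left (a := 0) (b := π / 2)
      (fun u => arsinh |cos u|) π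
    simp only [sub_zero, cos_pi_sub, abs_neg, sub_half] at this
    exact this.symm
  have hscale := intervalIntegral.integral_comp_div (a := 0) (b := 2 * π)
    (fun u => arsinh |cos u|) (two_ne_zero (α := ℝ))
  rw [zero_div, mul_div_cancel_left₀ π two_ne_zero] at hscale
  rw [hscale, ← intervalIntegral.integral_add_adjacent_intervals
    (hcont.intervalIntegrable 0 (π / 2)) (hcont.intervalIntegrable (π / 2) π), hsecond, hfirst,
    smul_eq_mul]
  ring

theorem integral_sin_div_sqrt_one_add_sq {x : ℝ} (hx : 0 < x) :
    ∫ u in (0:ℝ)..(π / 2), sin u * (√(1 + (x * sin u) ^ 2))⁻¹ = arctan x / x := by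
  have hderiv : ∀ u : ℝ, HasDerivAt (fun u => -(arcsin (x * cos u / √(1 + x ^ 2)) / x))
      (sin u * (√(1 + (x * sin u) ^ 2))⁻¹) u := by
    intro u
    have hs : 0 < √(1 + x ^ 2) := by positivity
    have hss : √(1 + x ^ 2) ^ 2 = 1 + x ^ 2 := sq_sqrt (by positivity)
    have hlt : |x * cos u / √(1 + x ^ 2)| < 1 := by
      rw [← sq_lt_one_iff_abs_lt_one, div_pow, hss, div_lt_one (by positivity)]
      nlinarith [cos_sq_le_one u, sq_nonneg x]
    obtain ⟨h1, h2⟩ := abs_lt.1 hlt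
    have hval : √(1 - (x * cos u / √(1 + x ^ 2)) ^ 2)
        = √(1 + (x * sin u) ^ 2) / √(1 + x ^ 2) := by
      rw [← sqrt_div (by positivity), div_pow, hss]
      congr 1
      rw [eq_div_iff (by positivity)]
      field_simp
      linear_combination (-x ^ 2) * sin_sq_add_cos_sq u
    have := (((hasDerivAt_arcsin h1.ne' h2.ne).comp u
      (((hasDerivAt_cos u).const_mul x).div_const _)).div_const x).neg
    refine this.congr_deriv ?_
    rw [hval]
    have : √(1 + (x * sin u) ^ 2) ≠ 0 := by positivity
    field_simp
  have hcont : Continuous fun u => sin u * (√(1 + (x * sin u) ^ 2))⁻¹ := by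
    fun_prop (disch := intros; positivity)
  rw [intervalIntegral.integral_eq_sub_of_hasDerivAt (fun u _ => hderiv u)
    (hcont.intervalIntegrable _ _), arctan_eq_arcsin]
  simp

theorem integral_arsinh_sin_eq_integral_arctan_div :
    ∫ u in (0:ℝ)..(π / 2), arsinh (sin u) = ∫ x in (0:ℝ)..1, arctan x / x := by
  have hcont : Continuous fun p : ℝ × ℝ => sin p.1 * (√(1 + (p.2 * sin p.1) ^ 2))⁻¹ := by
    fun_prop (disch := intros; positivity)
  have hinner : ∀ u : ℝ,
      ∫ x in (0:ℝ)..1, sin u * (√(1 + (x * sin u) ^ 2))⁻¹ = arsinh (sin u) := by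
    intro u
    have hderiv : ∀ x : ℝ, HasDerivAt (fun x => arsinh (x * sin u))
        (sin u * (√(1 + (x * sin u) ^ 2))⁻¹) x := by
      intro x
      convert (hasDerivAt_mul_const (sin u)).arsinh using 1
      simp [mul_comm]
    have hu : Continuous fun x : ℝ => sin u * (√(1 + (x * sin u) ^ 2))⁻¹ := by
      fun_prop (disch := intros; positivity)
    rw [intervalIntegral.integral_eq_sub_of_hasDerivAt (fun x _ => hderiv x)
      (hu.intervalIntegrable _ _)]
    simp
  simp_rw [← hinner]
  rw [MeasureTheory.intervalIntegral_intervalIntegral_swap]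
  · refine intervalIntegral.integral_congr_ae (Filter.Eventually.of_forall fun x hx => ?_)
    rw [Set.uIoc_of_le zero_le_one] at hx
    exact integral_sin_div_sqrt_one_add_sq hx.1
  · refine (hcont.continuousOn.integrableOn_compact
      (isCompact_uIcc.prod isCompact_uIcc)).mono_set
      (Set.prod_mono Set.uIoc_subset_uIcc Set.uIoc_subset_uIcc)

theorem summable_one_div_odd_sq : Summable fun n : ℕ => 1 / ((2 * n + 1 : ℕ) : ℝ) ^ 2 :=
  (summable_one_div_nat_pow.2 one_lt_two).comp_injective
    (i := fun n : ℕ => 2 * n + 1) fun a b h => by simpa using h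

/-- The integral of `arctan x / x` over the unit interval is Catalan's constant. -/
theorem hasSum_integral_arctan_div :
    HasSum (fun n : ℕ => (-1 : ℝ) ^ n / ((2 * n + 1 : ℕ) : ℝ) ^ 2)
      (∫ x in (0:ℝ)..1, arctan x / x) := by
  have hnorm : ∀ n : ℕ,
      ∫ x in Set.Ioc (0:ℝ) 1, ‖(-1 : ℝ) ^ n * x ^ (2 * n) / ((2 * n + 1 : ℕ) : ℝ)‖
      = 1 / ((2 * n + 1 : ℕ) : ℝ) ^ 2 := by
    intro n
    rw [← intervalIntegral.integral_of_le zero_le_one]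
    simp only [norm_div, norm_mul, norm_pow, norm_neg, norm_one, one_pow, one_mul, pow_mul,
      norm_eq_abs, sq_abs, Nat.abs_cast]
    simp only [← pow_mul]
    rw [intervalIntegral.integral_div, integral_pow]
    push_cast
    field_simp
    simp
  have hval : ∀ n : ℕ, ∫ x in Set.Ioc (0:ℝ) 1, (-1 : ℝ) ^ n * x ^ (2 * n) / ((2 * n + 1 : ℕ) : ℝ)
      = (-1 : ℝ) ^ n / ((2 * n + 1 : ℕ) : ℝ) ^ 2 := by
    intro n
    rw [← intervalIntegral.integral_of_le zero_le_one, intervalIntegral.integral_div,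
      intervalIntegral.integral_const_mul, integral_pow]
    push_cast
    field_simp
    simp
  have hintegrable : ∀ n : ℕ, MeasureTheory.Integrable
      (fun x : ℝ => (-1 : ℝ) ^ n * x ^ (2 * n) / ((2 * n + 1 : ℕ) : ℝ))
      (MeasureTheory.volume.restrict (Set.Ioc (0:ℝ) 1)) := by
    intro n
    have hc : Continuous fun x : ℝ => (-1 : ℝ) ^ n * x ^ (2 * n) / ((2 * n + 1 : ℕ) : ℝ) := by
      fun_prop
    exact (hc.intervalIntegrable 0 1).1
  have hsum := MeasureTheory.hasSum_integral_of_summable_integral_norm hintegrable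
    (by simpa only [hnorm] using summable_one_div_odd_sq)
  simp only [hval] at hsum
  suffices h : ∫ x in (0:ℝ)..1, arctan x / x = ∫ x in Set.Ioc (0:ℝ) 1,
      ∑' n : ℕ, (-1 : ℝ) ^ n * x ^ (2 * n) / ((2 * n + 1 : ℕ) : ℝ) by rwa [h]
  rw [intervalIntegral.integral_of_le zero_le_one, MeasureTheory.integral_Ioc_eq_integral_Ioo,
    MeasureTheory.integral_Ioc_eq_integral_Ioo]
  refine MeasureTheory.setIntegral_congr_fun measurableSet_Ioo fun x hx => ?_
  have hx1 : ‖x‖ < 1 := by rw [norm_eq_abs, abs_of_pos hx.1]; exact hx.2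
  have hne : x ≠ 0 := hx.1.ne'
  rw [← ((hasSum_arctan hx1).div_const x).tsum_eq]
  refine tsum_congr fun n => ?_
  field_simp
  ring

theorem tsum_chi_four_div_sq :
    ∑' n : ℕ, (if n % 4 = 1 then (1:ℝ) else if n % 4 = 3 then -1 else 0) / (n:ℝ) ^ 2
      = ∑' n : ℕ, (-1 : ℝ) ^ n / ((2 * n + 1 : ℕ) : ℝ) ^ 2 := by
  have hinj : Function.Injective fun n : ℕ => 2 * n + 1 := fun a b h => by simpa using h
  rw [← hinj.tsum_eq]
  · refine tsum_congr fun n => ?_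
    rcases Nat.even_or_odd n with h | h
    · rw [h.neg_one_pow, if_pos]
      obtain ⟨k, rfl⟩ := h
      omega
    · rw [h.neg_one_pow, if_neg, if_pos] <;> obtain ⟨k, rfl⟩ := h <;> omega
  · intro n hn
    by_contra hodd
    have heven : Even n := by
      rw [← Nat.not_odd_iff_even]
      rintro ⟨k, rfl⟩
      exact hodd ⟨k, rfl⟩
    obtain ⟨k, rfl⟩ := heven
    refine hn ?_
    dsimp only
    rw [if_neg (by omega), if_neg (by omega), zero_div]

/-- For the characteristic polynomial `p(z,w) = −(4 + z + 1/z + w + 1/w)` of the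
toroidal dimer model for the square weave, `2π · m(p) = 8 · L(χ₋₄, 2)`, where
`χ₋₄` is the unique nontrivial Dirichlet character mod 4; equivalently
`∫₀^{2π}∫₀^{2π} log(4 + 2 cos s + 2 cos t) ds dt = 16π · L(χ₋₄, 2)`. -/
theorem mahler_square_weave_eq_catalan :
    (∫ s in (0:ℝ)..(2*π), ∫ t in (0:ℝ)..(2*π),
        Real.log (4 + 2 * Real.cos s + 2 * Real.cos t))
      = 16 * π *
        ∑' n : ℕ, (if n % 4 = 1 then (1:ℝ) else if n % 4 = 3 then -1 else 0) / (n:ℝ) ^ 2 := by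
  simp_rw [integral_log_four_add_two_mul_cos]
  rw [intervalIntegral.integral_const_mul, integral_arsinh_abs_cos_half,
    integral_arsinh_sin_eq_integral_arctan_div, ← hasSum_integral_arctan_div.tsum_eq,
    tsum_chi_four_div_sq]
  ring
end

section
/- Let p(z,w) = 6 − (w + 1/w + z + 1/z + w/z + z/w) be the characteristic polynomial of the toroidal dimer model on the overlaid bipartite graph of the biperiodic triaxial link 𝓛 (the overlay of the regular hexagonal tiling and the regular triangular tiling). Then 2π · m(p) = (15√3/2) · L(χ₋₃, 2), where m is the two-variable Mahler measure; equivalently, ∫₀^{2π} ∫₀^{2π} log (6 − 2 cos s − 2 cos t − 2 cos(s − t)) ds dt = 15√3 · π · L(χ₋₃, 2). (This is the paper's computation 2π·m(p(z,w)) = 10·v_tet for the triaxial link, since v_tet = (3√3/4)·L(χ₋₃,2).) -/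
open Real
open MeasureTheory Filter Topology

theorem hasSum_log_one_sub {r : ℝ} (hr : |r| < 1) (y : ℝ) :
    HasSum (fun n : ℕ => -2 * r ^ n * Real.cos (n * y) / n)
      (Real.log (1 - 2 * r * Real.cos y + r ^ 2)) := by
  have hz : ‖(r : ℂ) * Complex.exp (y * Complex.I)‖ < 1 := by
    rw [norm_mul, Complex.norm_exp_ofReal_mul_I, mul_one, Complex.norm_real]; exact hr
  have h := Complex.hasSum_re (Complex.hasSum_taylorSeries_neg_log hz)
  rw [Complex.neg_re, Complex.log_re] at h
  have hn : Real.log (1 - 2 * r * Real.cos y + r ^ 2)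
      = -2 * -Real.log ‖1 - (r : ℂ) * Complex.exp (y * Complex.I)‖ := by
    have : 1 - 2 * r * Real.cos y + r ^ 2
        = ‖1 - (r : ℂ) * Complex.exp (y * Complex.I)‖ ^ 2 := by
      rw [Complex.sq_norm, Complex.normSq_apply]
      simp only [Complex.sub_re, Complex.one_re, Complex.re_ofReal_mul,
        Complex.exp_ofReal_mul_I_re, Complex.sub_im, Complex.one_im, Complex.im_ofReal_mul,
        Complex.exp_ofReal_mul_I_im]
      linear_combination (-r ^ 2) * Real.sin_sq_add_cos_sq y
    rw [this, Real.log_pow]; push_cast; ring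
  rw [hn]
  refine (h.mul_left (-2)).congr_fun fun n => ?_
  have : ((r : ℂ) * Complex.exp (y * Complex.I)) ^ n / n
      = ((r ^ n / n : ℝ) : ℂ) * Complex.exp ((n * y : ℝ) * Complex.I) := by
    rw [mul_pow, ← Complex.exp_nat_mul]; push_cast; ring_nf
  rw [this, Complex.re_ofReal_mul, Complex.exp_ofReal_mul_I_re]
  ring

theorem integral_cos_nat_mul (n : ℕ) (hn : n ≠ 0) (a : ℝ) :
    ∫ y in (0:ℝ)..a, Real.cos (n * y) = Real.sin (n * a) / n := by
  have : (n : ℝ) ≠ 0 := by exact_mod_cast hn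
  rw [intervalIntegral.integral_comp_mul_left _ this, integral_cos]
  simp [div_eq_inv_mul]

theorem hasSum_integral_log_one_sub {r : ℝ} (hr : |r| < 1) (a : ℝ) :
    HasSum (fun n : ℕ => -2 * r ^ n * (Real.sin (n * a) / n ^ 2))
      (∫ y in (0:ℝ)..a, Real.log (1 - 2 * r * Real.cos y + r ^ 2)) := by
  have h := intervalIntegral.hasSum_integral_of_dominated_convergence (a := 0) (b := a)
    (μ := volume) (F := fun (n : ℕ) y => -2 * r ^ n * Real.cos (n * y) / n)
    (f := fun y => Real.log (1 - 2 * r * Real.cos y + r ^ 2))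
    (fun n _ => 2 * |r| ^ n) (fun n => by fun_prop) ?_ ?_ ?_ ?_
  · refine h.congr_fun fun n => ?_
    rcases eq_or_ne n 0 with rfl | hn
    · simp
    · simp only [mul_div_assoc, intervalIntegral.integral_const_mul,
        intervalIntegral.integral_div, integral_cos_nat_mul n hn]
      field_simp
  · refine fun n => ae_of_all _ fun y _ => ?_
    rcases eq_or_ne n 0 with rfl | hn
    · simp
    · have h1 : (1 : ℝ) ≤ n := by exact_mod_cast Nat.one_le_iff_ne_zero.2 hn
      rw [norm_div, norm_mul, norm_mul, norm_pow]
      simp only [Real.norm_eq_abs, abs_neg, Nat.abs_cast, abs_two]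
      refine (div_le_self (by positivity) h1).trans ?_
      exact mul_le_of_le_one_right (by positivity) (Real.abs_cos_le_one _)
  · exact ae_of_all _ fun y _ => (summable_geometric_of_lt_one (abs_nonneg r) hr).mul_left 2
  · exact intervalIntegrable_const
  · exact ae_of_all _ fun y _ => hasSum_log_one_sub hr y

theorem integral_log_one_sub_period {r : ℝ} (hr : |r| < 1) :
    ∫ y in (0:ℝ)..(2 * π), Real.log (1 - 2 * r * Real.cos y + r ^ 2) = 0 := by
  refine (hasSum_integral_log_one_sub hr (2 * π)).unique ?_
  have : (fun n : ℕ => -2 * r ^ n * (Real.sin (n * (2 * π)) / n ^ 2)) = fun _ => 0 := by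
    funext n
    have := Real.sin_nat_mul_pi (n * 2)
    push_cast at this
    rw [← mul_assoc, this]; simp
  rw [this]; exact hasSum_zero

theorem integral_log_two_sub_two_cos {a : ℝ} (ha0 : 0 ≤ a) (ha : a < π) :
    ∫ y in (0:ℝ)..a, Real.log (2 - 2 * Real.cos y)
      = -2 * ∑' n : ℕ, Real.sin (n * a) / (n : ℝ) ^ 2 := by
  have hs : Summable fun n : ℕ => 2 * (1 / (n : ℝ) ^ 2) :=
    (Real.summable_one_div_nat_pow.2 one_lt_two).mul_left 2
  have hev : ∀ᶠ r : ℝ in 𝓝[<] 1, 0 < r ∧ r < 1 :=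
    (Ioo_mem_nhdsLT (show (0:ℝ) < 1 by norm_num))
  have h1 : Tendsto (fun r : ℝ => ∑' n : ℕ, -2 * r ^ n * (Real.sin (n * a) / (n : ℝ) ^ 2))
      (𝓝[<] 1) (𝓝 (∑' n : ℕ, -2 * 1 ^ n * (Real.sin (n * a) / (n : ℝ) ^ 2))) := by
    refine tendsto_tsum_of_dominated_convergence hs (fun n => ?_) ?_
    · have : Continuous fun r : ℝ => -2 * r ^ n * (Real.sin (n * a) / (n : ℝ) ^ 2) := by fun_prop
      exact (this.tendsto 1).mono_left nhdsWithin_le_nhds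
    · filter_upwards [hev] with r hr n
      rw [norm_mul, norm_mul, norm_div, norm_pow, norm_pow]
      simp only [Real.norm_eq_abs, abs_neg, Nat.abs_cast, abs_two, abs_of_pos hr.1]
      have := pow_le_one₀ hr.1.le hr.2.le (n := n)
      have := Real.abs_sin_le_one (n * a)
      have : 2 * r ^ n ≤ 2 := by linarith
      gcongr
  have h2 : Tendsto (fun r : ℝ => ∫ y in (0:ℝ)..a, Real.log (1 - 2 * r * Real.cos y + r ^ 2))
      (𝓝[<] 1) (𝓝 (∫ y in (0:ℝ)..a, Real.log (2 - 2 * Real.cos y))) := by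
    have hpos : ∀ r y : ℝ, y ∈ Set.uIoc 0 a → 0 < Real.sin y ^ 2 ∧
        Real.sin y ^ 2 ≤ 1 - 2 * r * Real.cos y + r ^ 2 := by
      intro r y hy
      rw [Set.uIoc_of_le ha0] at hy
      refine ⟨pow_pos (Real.sin_pos_of_pos_of_lt_pi hy.1 (hy.2.trans_lt ha)) 2, ?_⟩
      nlinarith [Real.sin_sq_add_cos_sq y, sq_nonneg (r - Real.cos y)]
    refine intervalIntegral.tendsto_integral_filter_of_dominated_convergence
      (fun y => Real.log 4 + 2 * |Real.log (Real.sin y)|) ?_ ?_ ?_ ?_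
    · refine Eventually.of_forall fun r => Measurable.aestronglyMeasurable ?_
      fun_prop
    · filter_upwards [hev] with r hr
      refine ae_of_all _ fun y hy => ?_
      obtain ⟨hp, hle⟩ := hpos r y hy
      have hu : 1 - 2 * r * Real.cos y + r ^ 2 ≤ 4 := by
        nlinarith [Real.neg_one_le_cos y, hr.1, hr.2]
      have l1 := Real.log_le_log hp hle
      have l2 := Real.log_le_log (hp.trans_le hle) hu
      rw [Real.log_pow] at l1
      push_cast at l1
      have l3 : 0 ≤ Real.log 4 := Real.log_nonneg (by norm_num)
      rw [Real.norm_eq_abs, abs_le]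
      constructor <;> linarith [neg_abs_le (Real.log (Real.sin y)),
        abs_nonneg (Real.log (Real.sin y))]
    · exact intervalIntegrable_const.add ((intervalIntegrable_log_sin.abs).const_mul 2)
    · refine ae_of_all _ fun y hy => ?_
      obtain ⟨hp, hle⟩ := hpos 1 y hy
      have hc : ContinuousAt (fun r : ℝ => Real.log (1 - 2 * r * Real.cos y + r ^ 2)) 1 :=
        ContinuousAt.log (by fun_prop) (hp.trans_le hle).ne'
      have := hc.tendsto.mono_left (nhdsWithin_le_nhds (s := Set.Iio 1))
      convert this using 3
      ring
  rw [tendsto_nhds_unique h2 (h1.congr' ?_), ← tsum_mul_left]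
  · simp
  · filter_upwards [hev] with r hr
    exact (hasSum_integral_log_one_sub (by rw [abs_of_pos hr.1]; exact hr.2) a).tsum_eq

theorem sin_nat_mul_two_pi_div_three (n : ℕ) : Real.sin (n * (2 * π / 3))
    = √3 / 2 * (if n % 3 = 1 then (1:ℝ) else if n % 3 = 2 then -1 else 0) := by
  obtain ⟨k, hk⟩ : ∃ k, n = n % 3 + 3 * k := ⟨n / 3, (Nat.mod_add_div n 3).symm⟩
  have h3 : n % 3 < 3 := Nat.mod_lt _ (by norm_num)
  have e : (n : ℝ) * (2 * π / 3) = ((n % 3 : ℕ) : ℝ) * (2 * π / 3) + k * (2 * π) := by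
    have : (n : ℝ) = ((n % 3 : ℕ) : ℝ) + 3 * k := by exact_mod_cast hk
    linear_combination (2 * π / 3) * this
  rw [e, Real.sin_add_nat_mul_two_pi]
  have h1 : Real.sin (2 * π / 3) = √3 / 2 := by
    rw [show 2 * π / 3 = π - π / 3 by ring, Real.sin_pi_sub, Real.sin_pi_div_three]
  have h2 : Real.sin (2 * (2 * π / 3)) = -(√3 / 2) := by
    rw [show 2 * (2 * π / 3) = π / 3 + π by ring, Real.sin_add_pi, Real.sin_pi_div_three]
  interval_cases n % 3 <;> simp [h1, h2]

theorem intervalIntegrable_log_sin_apply (a b : ℝ) :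
    IntervalIntegrable (fun x => Real.log (Real.sin x)) volume a b :=
  intervalIntegrable_log_sin

theorem intervalIntegrable_log_cos_apply (a b : ℝ) :
    IntervalIntegrable (fun x => Real.log (Real.cos x)) volume a b :=
  intervalIntegrable_log_cos

theorem integral_log_sin_zero_pi_div_three : ∫ x in (0:ℝ)..(π / 3), Real.log (Real.sin x)
    = -(√3 / 4) * (∑' n : ℕ,
        (if n % 3 = 1 then (1:ℝ) else if n % 3 = 2 then -1 else 0) / (n:ℝ) ^ 2)
      - π / 3 * Real.log 2 := by
  have h := integral_log_two_sub_two_cos (a := 2 * π / 3) (by positivity) (by linarith [pi_pos])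
  simp only [sin_nat_mul_two_pi_div_three, mul_div_assoc (√3 / 2), tsum_mul_left] at h
  have h2 : ∫ y in (0:ℝ)..(2 * π / 3), Real.log (2 - 2 * Real.cos y)
      = 2 * ∫ x in (0:ℝ)..(π / 3), Real.log (2 - 2 * Real.cos (2 * x)) := by
    have := intervalIntegral.mul_integral_comp_mul_left (a := 0) (b := π / 3) (c := 2)
      (f := fun y => Real.log (2 - 2 * Real.cos y))
    rw [this]; congr 1 <;> ring
  have h3 : ∫ x in (0:ℝ)..(π / 3), Real.log (2 - 2 * Real.cos (2 * x))
      = ∫ x in (0:ℝ)..(π / 3), (2 * Real.log 2 + 2 * Real.log (Real.sin x)) := by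
    refine intervalIntegral.integral_congr_ae (ae_of_all _ fun x hx => ?_)
    rw [Set.uIoc_of_le (by positivity)] at hx
    have hs := Real.sin_pos_of_pos_of_lt_pi hx.1 (by linarith [hx.2, pi_pos])
    have : 2 - 2 * Real.cos (2 * x) = (2 * Real.sin x) ^ 2 := by
      rw [Real.cos_two_mul]; linear_combination (-4) * Real.sin_sq_add_cos_sq x
    rw [this, Real.log_pow, Real.log_mul two_ne_zero hs.ne']; push_cast; ring
  rw [h2, h3, intervalIntegral.integral_add intervalIntegrable_const
    ((intervalIntegrable_log_sin_apply _ _).const_mul 2), intervalIntegral.integral_const_mul,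
    intervalIntegral.integral_const] at h
  simp only [intervalIntegral.integral_const_mul, smul_eq_mul, sub_zero] at h
  linarith

theorem integral_log_cos_eq_sub (a : ℝ) : ∫ x in (0:ℝ)..a, Real.log (Real.cos x)
    = (∫ x in (0:ℝ)..(π / 2), Real.log (Real.sin x))
      - ∫ x in (0:ℝ)..(π / 2 - a), Real.log (Real.sin x) := by
  rw [intervalIntegral.integral_interval_sub_left (intervalIntegrable_log_sin_apply _ _)
    (intervalIntegrable_log_sin_apply _ _)]
  simp only [← Real.sin_pi_div_two_sub]
  rw [intervalIntegral.integral_comp_sub_left (fun x => Real.log (Real.sin x))]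
  simp

theorem integral_log_sin_duplication : ∫ x in (0:ℝ)..(π / 3), Real.log (Real.sin x)
    = 2 * (π / 6 * Real.log 2 + (∫ x in (0:ℝ)..(π / 6), Real.log (Real.sin x))
      + ∫ x in (0:ℝ)..(π / 6), Real.log (Real.cos x)) := by
  have := intervalIntegral.mul_integral_comp_mul_left (a := 0) (b := π / 6) (c := 2)
      (f := fun y => Real.log (Real.sin y))
  rw [show (2 : ℝ) * (π / 6) = π / 3 by ring, mul_zero] at this
  rw [← this]
  have h3 : ∫ x in (0:ℝ)..(π / 6), Real.log (Real.sin (2 * x))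
      = ∫ x in (0:ℝ)..(π / 6), (Real.log 2 + Real.log (Real.sin x) + Real.log (Real.cos x)) := by
    refine intervalIntegral.integral_congr_ae (ae_of_all _ fun x hx => ?_)
    rw [Set.uIoc_of_le (by positivity)] at hx
    have hs := Real.sin_pos_of_pos_of_lt_pi hx.1 (by linarith [hx.2, pi_pos])
    have hc := Real.cos_pos_of_mem_Ioo (x := x)
      ⟨by linarith [hx.1, pi_pos], by linarith [hx.2, pi_pos]⟩
    rw [Real.sin_two_mul, Real.log_mul (by positivity) hc.ne', Real.log_mul two_ne_zero hs.ne']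
  rw [h3, intervalIntegral.integral_add (intervalIntegrable_const.add (intervalIntegrable_log_sin_apply _ _))
    (intervalIntegrable_log_cos_apply _ _), intervalIntegral.integral_add intervalIntegrable_const
    (intervalIntegrable_log_sin_apply _ _), intervalIntegral.integral_const]
  simp

theorem integral_log_sin_zero_pi_div_six : ∫ x in (0:ℝ)..(π / 6), Real.log (Real.sin x)
    = 3 / 2 * (∫ x in (0:ℝ)..(π / 3), Real.log (Real.sin x)) + π / 3 * Real.log 2 := by
  have h := integral_log_sin_duplication
  rw [integral_log_cos_eq_sub, integral_log_sin_zero_pi_div_two,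
    show π / 2 - π / 6 = π / 3 by ring] at h
  linarith

theorem hasDerivAt_integral_log_sin {x : ℝ} (hx : Real.sin x ≠ 0) :
    HasDerivAt (fun u => ∫ t in (0:ℝ)..u, Real.log (Real.sin t)) (Real.log (Real.sin x)) x :=
  intervalIntegral.integral_hasDerivAt_right (intervalIntegrable_log_sin_apply _ _)
    ((by fun_prop : Measurable fun t => Real.log (Real.sin t)).stronglyMeasurable
      |>.stronglyMeasurableAtFilter)
    (Real.continuous_sin.continuousAt.log hx)

theorem hasDerivAt_integral_log_cos {x : ℝ} (hx : Real.cos x ≠ 0) :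
    HasDerivAt (fun u => ∫ t in (0:ℝ)..u, Real.log (Real.cos t)) (Real.log (Real.cos x)) x :=
  intervalIntegral.integral_hasDerivAt_right (intervalIntegrable_log_cos_apply _ _)
    ((by fun_prop : Measurable fun t => Real.log (Real.cos t)).stronglyMeasurable
      |>.stronglyMeasurableAtFilter)
    (Real.continuous_cos.continuousAt.log hx)

/-- The angle with sine `sin φ / 2`. -/
noncomputable def halfSineAngle (φ : ℝ) : ℝ := Real.arcsin (Real.sin φ / 2)

theorem sin_halfSineAngle (φ : ℝ) : Real.sin (halfSineAngle φ) = Real.sin φ / 2 :=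
  Real.sin_arcsin (by linarith [Real.neg_one_le_sin φ]) (by linarith [Real.sin_le_one φ])

theorem continuous_halfSineAngle : Continuous halfSineAngle := by
  unfold halfSineAngle; fun_prop

theorem differentiable_halfSineAngle : Differentiable ℝ halfSineAngle := by
  intro φ
  unfold halfSineAngle
  have : DifferentiableAt ℝ Real.arcsin (Real.sin φ / 2) :=
    Real.differentiableAt_arcsin.2
      ⟨by linarith [Real.neg_one_le_sin φ], by linarith [Real.sin_le_one φ]⟩
  exact this.fun_comp' φ (by fun_prop)

theorem halfSineAngle_neg (φ : ℝ) : halfSineAngle (-φ) = -halfSineAngle φ := by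
  simp [halfSineAngle, neg_div, Real.arcsin_neg]

theorem abs_halfSineAngle_le (φ : ℝ) : |halfSineAngle φ| ≤ π / 6 := by
  have h : ∀ ψ, halfSineAngle ψ ≤ π / 6 := fun ψ => by
    unfold halfSineAngle
    rw [Real.arcsin_le_iff_le_sin' ⟨by linarith [pi_pos], by linarith [pi_pos]⟩,
      Real.sin_pi_div_six]
    linarith [Real.sin_le_one ψ]
  have := h (-φ)
  rw [halfSineAngle_neg] at this
  exact abs_le.2 ⟨by linarith, h φ⟩

theorem halfSineAngle_zero : halfSineAngle 0 = 0 := by simp [halfSineAngle]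

theorem halfSineAngle_pi_div_two : halfSineAngle (π / 2) = π / 6 := by
  rw [halfSineAngle, Real.sin_pi_div_two, ← Real.sin_pi_div_six,
    Real.arcsin_sin (by linarith [pi_pos]) (by linarith [pi_pos])]

theorem halfSineAngle_mem {φ : ℝ} (h0 : 0 < φ) (h1 : φ < π / 2) :
    0 < halfSineAngle φ ∧ halfSineAngle φ < φ := by
  have hs := Real.sin_pos_of_pos_of_lt_pi h0 (by linarith)
  refine ⟨Real.arcsin_pos.2 (by linarith), ?_⟩
  unfold halfSineAngle
  rw [Real.arcsin_lt_iff_lt_sin' ⟨by linarith, by linarith⟩]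
  linarith

theorem cos_half_add_halfSineAngle_pos {φ : ℝ} (hφ : |φ| ≤ π / 2) :
    0 < Real.cos ((φ + halfSineAngle φ) / 2) := by
  have h1 := abs_le.1 hφ
  have h2 := abs_le.1 (abs_halfSineAngle_le φ)
  exact Real.cos_pos_of_mem_Ioo ⟨by linarith [pi_pos], by linarith [pi_pos]⟩

theorem two_mul_sin_mul_cos_half (φ δ : ℝ) :
    2 * Real.sin ((φ - δ) / 2) * Real.cos ((φ + δ) / 2) = Real.sin φ - Real.sin δ :=
  (Real.sin_sub_sin φ δ).symm

theorem hasDerivAt_lobachevsky_combination {φ : ℝ} (h0 : 0 < φ) (h1 : φ < π / 2) :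
    HasDerivAt (fun φ => -2 * (∫ t in (0:ℝ)..((φ - halfSineAngle φ) / 2), Real.log (Real.sin t))
        - (∫ t in (0:ℝ)..(halfSineAngle φ), Real.log (Real.sin t))
        + 2 * (∫ t in (0:ℝ)..((φ + halfSineAngle φ) / 2), Real.log (Real.cos t))
        + (∫ t in (0:ℝ)..φ, Real.log (Real.sin t)) + Real.log 2 * (halfSineAngle φ + φ))
      (Real.log (8 * Real.cos ((φ + halfSineAngle φ) / 2) ^ 2)) φ := by
  obtain ⟨hd0, hd1⟩ := halfSineAngle_mem h0 h1
  have hδ := (differentiable_halfSineAngle φ).hasDerivAt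
  have hsin := sin_halfSineAngle φ
  have hid := two_mul_sin_mul_cos_half φ (halfSineAngle φ)
  have hc := cos_half_add_halfSineAngle_pos (φ := φ) (by rw [abs_of_pos h0]; exact h1.le)
  generalize deriv halfSineAngle φ = δ' at hδ
  have hα : 0 < Real.sin ((φ - halfSineAngle φ) / 2) :=
    Real.sin_pos_of_pos_of_lt_pi (by linarith) (by linarith)
  have hsd : 0 < Real.sin (halfSineAngle φ) :=
    Real.sin_pos_of_pos_of_lt_pi hd0 (by linarith)
  have hsφ : 0 < Real.sin φ := Real.sin_pos_of_pos_of_lt_pi h0 (by linarith)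
  have d1 := (hasDerivAt_integral_log_sin hα.ne').comp φ (((hasDerivAt_id φ).sub hδ).div_const 2)
  have d2 := (hasDerivAt_integral_log_sin hsd.ne').comp φ hδ
  have d3 := (hasDerivAt_integral_log_cos hc.ne').comp φ (((hasDerivAt_id φ).add hδ).div_const 2)
  have d4 := hasDerivAt_integral_log_sin hsφ.ne'
  have d5 := (hδ.add (hasDerivAt_id φ)).const_mul (Real.log 2)
  refine (((((d1.const_mul (-2)).sub d2).add (d3.const_mul 2)).add d4).add d5).congr_deriv ?_
  have e1 : Real.log (Real.sin (halfSineAngle φ))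
      = Real.log 2 + Real.log (Real.sin ((φ - halfSineAngle φ) / 2))
        + Real.log (Real.cos ((φ + halfSineAngle φ) / 2)) := by
    rw [← Real.log_mul two_ne_zero hα.ne', ← Real.log_mul (by positivity) hc.ne', hid]
    congr 1; linarith
  have e2 : Real.log (Real.sin φ) = Real.log 2 + Real.log (Real.sin (halfSineAngle φ)) := by
    rw [← Real.log_mul two_ne_zero hsd.ne']; congr 1; linarith
  have e3 : Real.log (8 * Real.cos ((φ + halfSineAngle φ) / 2) ^ 2)
      = 3 * Real.log 2 + 2 * Real.log (Real.cos ((φ + halfSineAngle φ) / 2)) := by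
    rw [Real.log_mul (by norm_num) (by positivity), Real.log_pow,
      show (8:ℝ) = 2 ^ 3 by norm_num, Real.log_pow]; push_cast; ring
  rw [e3, e2, e1]
  ring

theorem continuousOn_log_eight_mul_cos_sq :
    ContinuousOn (fun φ => Real.log (8 * Real.cos ((φ + halfSineAngle φ) / 2) ^ 2))
      (Set.Icc (-(π / 2)) (π / 2)) := by
  have := continuous_halfSineAngle
  refine ContinuousOn.log (by fun_prop) fun φ hφ => ?_
  have := cos_half_add_halfSineAngle_pos (abs_le.2 hφ)
  positivity

theorem integral_log_eight_mul_cos_sq :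
    ∫ φ in (0:ℝ)..(π / 2), Real.log (8 * Real.cos ((φ + halfSineAngle φ) / 2) ^ 2)
      = -5 * (∫ x in (0:ℝ)..(π / 6), Real.log (Real.sin x)) - 5 / 6 * π * Real.log 2 := by
  have hS : Continuous fun u => ∫ t in (0:ℝ)..u, Real.log (Real.sin t) :=
    intervalIntegral.continuous_primitive intervalIntegrable_log_sin_apply 0
  have hC : Continuous fun u => ∫ t in (0:ℝ)..u, Real.log (Real.cos t) :=
    intervalIntegral.continuous_primitive intervalIntegrable_log_cos_apply 0
  have hδ := continuous_halfSineAngle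
  have h := intervalIntegral.integral_eq_sub_of_hasDerivAt_of_le (a := 0) (b := π / 2)
    (by positivity) ?_ (fun φ hφ => hasDerivAt_lobachevsky_combination hφ.1 hφ.2) ?_
  · rw [h, halfSineAngle_zero, halfSineAngle_pi_div_two,
      show (π / 2 - π / 6) / 2 = π / 6 by ring, show (π / 2 + π / 6) / 2 = π / 3 by ring,
      integral_log_cos_eq_sub (π / 3), show π / 2 - π / 3 = π / 6 by ring,
      integral_log_sin_zero_pi_div_two]
    simp only [sub_zero, add_zero, zero_div, intervalIntegral.integral_same]
    ring
  · have c1 := hS.comp (show Continuous fun φ => (φ - halfSineAngle φ) / 2 by fun_prop)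
    have c2 := hS.comp hδ
    have c3 := hC.comp (show Continuous fun φ => (φ + halfSineAngle φ) / 2 by fun_prop)
    exact (((((continuous_const.mul c1).sub c2).add (continuous_const.mul c3)).add hS).add
      (continuous_const.mul (hδ.add continuous_id))).continuousOn
  · refine (continuousOn_log_eight_mul_cos_sq.mono ?_).intervalIntegrable
    rw [Set.uIcc_of_le (by positivity)]
    exact Set.Icc_subset_Icc (by linarith [pi_pos]) le_rfl

theorem cos_half_sq (x : ℝ) : Real.cos (x / 2) ^ 2 = 1 / 2 + Real.cos x / 2 := by
  rw [Real.cos_sq]; congr 3; ring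

theorem sin_half_sq (x : ℝ) : Real.sin (x / 2) ^ 2 = 1 / 2 - Real.cos x / 2 := by
  rw [Real.sin_sq_eq_half_sub]; congr 3; ring

theorem triaxial_eq_eight_mul (φ t : ℝ) :
    6 - 2 * Real.cos (π - 2 * φ) - 2 * Real.cos t - 2 * Real.cos (π - 2 * φ - t)
      = 8 * (Real.cos ((φ + halfSineAngle φ) / 2) ^ 2 + Real.sin ((φ - halfSineAngle φ) / 2) ^ 2
        - 2 * Real.cos ((φ + halfSineAngle φ) / 2) * Real.sin ((φ - halfSineAngle φ) / 2)
          * Real.cos (t - (π / 2 - φ))) := by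
  have hid := two_mul_sin_mul_cos_half φ (halfSineAngle φ)
  have hsin := sin_halfSineAngle φ
  have h3 : Real.cos t + Real.cos (π - 2 * φ - t)
      = 2 * Real.sin φ * Real.cos (t - (π / 2 - φ)) := by
    rw [Real.cos_add_cos, ← Real.cos_pi_div_two_sub]
    congr 2
    · congr 1; ring_nf
    · ring_nf
  rw [cos_half_sq, sin_half_sq, Real.cos_pi_sub, Real.cos_two_mul, Real.cos_add, Real.cos_sub φ]
  linear_combination (-2) * h3 + 8 * Real.cos (t - (π / 2 - φ)) * hid
    + (8 * Real.sin φ - 8 * Real.cos (t - (π / 2 - φ))) * hsin + 4 * Real.sin_sq_add_cos_sq φ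

theorem integral_log_sq_add_sq_sub {c d : ℝ} (hc : 0 < c) (hd : d ^ 2 < c ^ 2) (a : ℝ) :
    ∫ t in (0:ℝ)..(2 * π), Real.log (8 * (c ^ 2 + d ^ 2 - 2 * c * d * Real.cos (t - a)))
      = 2 * π * Real.log (8 * c ^ 2) := by
  have hr : |d / c| < 1 := by
    rw [abs_div, div_lt_one (abs_pos.2 hc.ne')]; exact sq_lt_sq.1 hd
  have hpos : ∀ y, 0 < 1 - 2 * (d / c) * Real.cos y + (d / c) ^ 2 := fun y => by
    have h1 := abs_lt.1 hr
    have h2 : (d / c) ^ 2 < 1 := by rwa [← sq_abs, sq_lt_one_iff₀ (abs_nonneg _)]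
    rcases eq_or_ne (d / c) 0 with h | h
    · simp [h]
    · have := abs_le.1 (Real.abs_cos_le_one y)
      nlinarith [Real.sin_sq_add_cos_sq y, sq_nonneg (d / c * Real.sin y),
        sq_nonneg (d / c * Real.cos y - 1), sq_nonneg (Real.sin y), sq_nonneg (d / c - Real.cos y)]
  have hper : Function.Periodic
      (fun y => Real.log (1 - 2 * (d / c) * Real.cos y + (d / c) ^ 2)) (2 * π) := fun y => by
    simp only [Real.cos_add_two_pi]
  have hcont : Continuous fun y => Real.log (1 - 2 * (d / c) * Real.cos (y - a) + (d / c) ^ 2) :=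
    Continuous.log (by fun_prop) fun y => (hpos _).ne'
  have hsplit : ∀ t, Real.log (8 * (c ^ 2 + d ^ 2 - 2 * c * d * Real.cos (t - a)))
      = Real.log (8 * c ^ 2) + Real.log (1 - 2 * (d / c) * Real.cos (t - a) + (d / c) ^ 2) := by
    intro t
    rw [← Real.log_mul (by positivity) (hpos _).ne']
    congr 1; field_simp
    ring
  simp only [hsplit]
  rw [intervalIntegral.integral_add intervalIntegrable_const (hcont.intervalIntegrable _ _),
    intervalIntegral.integral_comp_sub_right
      (fun y => Real.log (1 - 2 * (d / c) * Real.cos y + (d / c) ^ 2)),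
    show 2 * π - a = (0 - a) + 2 * π by ring, hper.intervalIntegral_add_eq (0 - a) 0, zero_add,
    integral_log_one_sub_period hr]
  simp

theorem integral_triaxial_inner {φ : ℝ} (hφ : |φ| < π / 2) :
    ∫ t in (0:ℝ)..(2 * π),
        Real.log (6 - 2 * Real.cos (π - 2 * φ) - 2 * Real.cos t - 2 * Real.cos (π - 2 * φ - t))
      = 2 * π * Real.log (8 * Real.cos ((φ + halfSineAngle φ) / 2) ^ 2) := by
  simp only [triaxial_eq_eight_mul]
  refine integral_log_sq_add_sq_sub (cos_half_add_halfSineAngle_pos hφ.le) ?_ _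
  have h1 := abs_lt.1 hφ
  have h2 := abs_le.1 (abs_halfSineAngle_le φ)
  have hc := Real.cos_pos_of_mem_Ioo (x := φ) ⟨by linarith, by linarith⟩
  have hc2 := Real.cos_pos_of_mem_Ioo (x := halfSineAngle φ)
    ⟨by linarith [pi_pos], by linarith [pi_pos]⟩
  rw [cos_half_sq, sin_half_sq, Real.cos_add, Real.cos_sub]
  nlinarith [mul_pos hc hc2]

theorem integral_symm_log_eight_mul_cos_sq :
    ∫ φ in (-(π / 2))..(π / 2), Real.log (8 * Real.cos ((φ + halfSineAngle φ) / 2) ^ 2)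
      = 2 * ∫ φ in (0:ℝ)..(π / 2), Real.log (8 * Real.cos ((φ + halfSineAngle φ) / 2) ^ 2) := by
  have hi : ∀ a b : ℝ, a ∈ Set.Icc (-(π / 2)) (π / 2) → b ∈ Set.Icc (-(π / 2)) (π / 2) →
      IntervalIntegrable (fun φ => Real.log (8 * Real.cos ((φ + halfSineAngle φ) / 2) ^ 2))
        volume a b := fun a b ha hb =>
    (continuousOn_log_eight_mul_cos_sq.mono (Set.uIcc_subset_Icc ha hb)).intervalIntegrable
  have hp := pi_pos
  rw [← intervalIntegral.integral_add_adjacent_intervals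
    (hi (-(π / 2)) 0 ⟨by linarith, by linarith⟩ ⟨by linarith, by linarith⟩)
    (hi 0 (π / 2) ⟨by linarith, by linarith⟩ ⟨by linarith, by linarith⟩), two_mul]
  congr 1
  have := intervalIntegral.integral_comp_neg (a := 0) (b := π / 2)
    (fun φ => Real.log (8 * Real.cos ((φ + halfSineAngle φ) / 2) ^ 2))
  rw [neg_zero] at this
  rw [← this]
  refine intervalIntegral.integral_congr fun φ _ => ?_
  simp only [halfSineAngle_neg]
  rw [← Real.cos_neg]
  congr 4; ring


/-- For the characteristic polynomial `p(z,w) = 6 − (w + 1/w + z + 1/z + w/z + z/w)`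
of the toroidal dimer model for the triaxial link, `2π · m(p) = (15√3/2) · L(χ₋₃, 2)`,
where `χ₋₃` is the unique nontrivial Dirichlet character mod 3; equivalently
`∫₀^{2π}∫₀^{2π} log(6 − 2 cos s − 2 cos t − 2 cos(s−t)) ds dt = 15√3 · π · L(χ₋₃, 2)`. -/
theorem mahler_triaxial_eq_L_chi3 :
    (∫ s in (0:ℝ)..(2*π), ∫ t in (0:ℝ)..(2*π),
        Real.log (6 - 2 * Real.cos s - 2 * Real.cos t - 2 * Real.cos (s - t)))
      = 15 * Real.sqrt 3 * π *
        ∑' n : ℕ, (if n % 3 = 1 then (1:ℝ) else if n % 3 = 2 then -1 else 0) / (n:ℝ) ^ 2 := by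
  have hcv : ∀ f : ℝ → ℝ, ∫ s in (0:ℝ)..(2 * π), f s
      = 2 * ∫ φ in (-(π / 2))..(π / 2), f (π - 2 * φ) := fun f => by
    rw [intervalIntegral.integral_comp_sub_mul f two_ne_zero, smul_eq_mul,
      mul_inv_cancel_left₀ two_ne_zero]
    congr 1 <;> ring
  rw [hcv, intervalIntegral.integral_congr_Ioo_of_le (by linarith [pi_pos]) fun φ hφ =>
      integral_triaxial_inner (abs_lt.2 hφ),
    intervalIntegral.integral_const_mul, integral_symm_log_eight_mul_cos_sq,
    integral_log_eight_mul_cos_sq, integral_log_sin_zero_pi_div_six,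
    integral_log_sin_zero_pi_div_three]
  ring
end

section
/- Let p(z,w) = 6 − (w + 1/w + z + 1/z + w/z + z/w) be the characteristic polynomial of the toroidal dimer model on the overlaid bipartite graph of the biperiodic triaxial link 𝓛. Then 2π · m(p) = 10·v_tet, where v_tet = 3Λ(π/3) is the hyperbolic volume of the regular ideal tetrahedron expressed via the Lobachevsky function; equivalently, ∫₀^{2π} ∫₀^{2π} log (6 − 2 cos s − 2 cos t − 2 cos(s − t)) ds dt = −60π ∫₀^{π/3} log |2 sin u| du. -/
open Real

/-- The Lobachevsky function `Λ(θ) = -∫₀^θ log |2 sin u| du`. -/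
noncomputable def lobachevsky (θ : ℝ) : ℝ := -∫ u in (0:ℝ)..θ, log |2 * sin u|

lemma intervalIntegrable_log_abs_two_mul_sin (a b : ℝ) :
    IntervalIntegrable (fun u ↦ log |2 * sin u|) MeasureTheory.volume a b := by
  have h : MeromorphicOn (fun u : ℝ ↦ 2 * sin u) (Set.uIcc a b) := fun x _ ↦ by
    have : AnalyticAt ℝ (fun u : ℝ ↦ 2 * sin u) x := by fun_prop
    exact this.meromorphicAt
  simpa only [Real.norm_eq_abs] using h.intervalIntegrable_log_norm

lemma continuous_lobachevsky : Continuous lobachevsky :=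
  (intervalIntegral.continuous_primitive intervalIntegrable_log_abs_two_mul_sin 0).neg

lemma hasDerivAt_lobachevsky {θ : ℝ} (h : sin θ ≠ 0) :
    HasDerivAt lobachevsky (-log |2 * sin θ|) θ := by
  have hmeas : Measurable fun u ↦ log |2 * sin u| := by fun_prop
  refine (intervalIntegral.integral_hasDerivAt_right
    (intervalIntegrable_log_abs_two_mul_sin 0 θ)
    hmeas.stronglyMeasurable.stronglyMeasurableAtFilter ?_).neg
  have : |2 * sin θ| ≠ 0 := by simpa using h
  fun_prop (disch := assumption)

lemma lobachevsky_zero : lobachevsky 0 = 0 := by simp [lobachevsky]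

lemma lobachevsky_pi_sub (θ : ℝ) : lobachevsky (π - θ) = lobachevsky π - lobachevsky θ := by
  have h := intervalIntegral.integral_comp_sub_left (a := 0) (b := θ)
    (fun u ↦ log |2 * sin u|) π
  simp only [sin_pi_sub, sub_zero] at h
  have h' := intervalIntegral.integral_add_adjacent_intervals
    (intervalIntegrable_log_abs_two_mul_sin 0 (π - θ))
    (intervalIntegrable_log_abs_two_mul_sin (π - θ) π)
  simp only [lobachevsky]
  linarith

lemma lobachevsky_two_mul (θ : ℝ) :
    lobachevsky (2 * θ) =
      2 * lobachevsky θ + 2 * (lobachevsky (θ + π / 2) - lobachevsky (π / 2)) := by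
  have hdup : ∫ u in (0:ℝ)..θ, log |2 * sin (2 * u)| =
      ∫ u in (0:ℝ)..θ, (log |2 * sin u| + log |2 * sin (u + π / 2)|) := by
    apply intervalIntegral.integral_congr_codiscreteWithin
    apply Filter.codiscreteWithin_mono (Set.subset_univ _)
    have hs : sin ⁻¹' {0}ᶜ ∈ Filter.codiscrete ℝ :=
      analyticOnNhd_sin.preimage_zero_mem_codiscrete (x := π / 2) (by simp)
    have hc : cos ⁻¹' {0}ᶜ ∈ Filter.codiscrete ℝ :=
      analyticOnNhd_cos.preimage_zero_mem_codiscrete (x := 0) (by simp)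
    filter_upwards [hs, hc] with u hsu hcu
    have hsu' : 2 * sin u ≠ 0 := mul_ne_zero two_ne_zero hsu
    have hcu' : 2 * cos u ≠ 0 := mul_ne_zero two_ne_zero hcu
    rw [sin_add_pi_div_two, sin_two_mul, log_abs, log_abs, log_abs, ← log_mul hsu' hcu']
    ring_nf
  have hshift := intervalIntegral.integral_comp_add_right (a := 0) (b := θ)
    (fun u ↦ log |2 * sin u|) (π / 2)
  have hscale := intervalIntegral.integral_comp_mul_left (a := 0) (b := θ)
    (fun u ↦ log |2 * sin u|) (two_ne_zero (α := ℝ))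
  have hintegral : IntervalIntegrable (fun u ↦ log |2 * sin (u + π / 2)|)
      MeasureTheory.volume 0 θ := by
    simpa using (intervalIntegrable_log_abs_two_mul_sin (0 + π / 2) (θ + π / 2)).comp_add_right
      (π / 2)
  rw [intervalIntegral.integral_add (intervalIntegrable_log_abs_two_mul_sin 0 θ) hintegral,
    hshift, hscale] at hdup
  have hadj := intervalIntegral.integral_add_adjacent_intervals
    (intervalIntegrable_log_abs_two_mul_sin 0 (π / 2))
    (intervalIntegrable_log_abs_two_mul_sin (π / 2) (θ + π / 2))
  simp only [lobachevsky]
  simp only [zero_add, mul_zero, smul_eq_mul] at hdup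
  linarith

lemma lobachevsky_pi : lobachevsky π = 0 := by
  have h := lobachevsky_two_mul (π / 2)
  rw [add_halves, show 2 * (π / 2) = π by ring] at h
  linarith

lemma lobachevsky_pi_div_two : lobachevsky (π / 2) = 0 := by
  have h := lobachevsky_pi_sub (π / 2)
  rw [sub_half, lobachevsky_pi] at h
  linarith

lemma lobachevsky_pi_div_six : lobachevsky (π / 6) = 3 / 2 * lobachevsky (π / 3) := by
  have h := lobachevsky_two_mul (π / 6)
  have h' := lobachevsky_pi_sub (π / 3)
  rw [show 2 * (π / 6) = π / 3 by ring, show π / 6 + π / 2 = π - π / 3 by ring,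
    lobachevsky_pi_div_two] at h
  rw [lobachevsky_pi] at h'
  linarith

/-- The larger root of `q² - (8 - 4c²) q + 4c² = 0`. -/
noncomputable def triaxialRoot (c : ℝ) : ℝ := 4 - 2 * c ^ 2 + 2 * √((1 - c ^ 2) * (4 - c ^ 2))

lemma continuous_triaxialRoot : Continuous triaxialRoot := by
  unfold triaxialRoot; fun_prop

lemma two_le_triaxialRoot {c : ℝ} (hc : c ^ 2 ≤ 1) : 2 ≤ triaxialRoot c := by
  have := sqrt_nonneg ((1 - c ^ 2) * (4 - c ^ 2))
  unfold triaxialRoot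
  linarith

lemma triaxialRoot_quadratic {c : ℝ} (hc : c ^ 2 ≤ 1) :
    triaxialRoot c ^ 2 + 4 * c ^ 2 = (8 - 4 * c ^ 2) * triaxialRoot c := by
  have := sq_sqrt (show 0 ≤ (1 - c ^ 2) * (4 - c ^ 2) from
    mul_nonneg (by linarith) (by linarith))
  unfold triaxialRoot
  linear_combination 4 * this

lemma triaxialRoot_eq {c q : ℝ} (hq : q ^ 2 + 4 * c ^ 2 = (8 - 4 * c ^ 2) * q)
    (hle : 4 - 2 * c ^ 2 ≤ q) : triaxialRoot c = q := by
  have : (1 - c ^ 2) * (4 - c ^ 2) = ((q - (4 - 2 * c ^ 2)) / 2) ^ 2 := by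
    linear_combination (-1 / 4) * hq
  rw [triaxialRoot, this, sqrt_sq (by linarith)]
  ring

lemma triaxialRoot_neg (c : ℝ) : triaxialRoot (-c) = triaxialRoot c := by
  simp [triaxialRoot]

lemma integral_log_triaxial_inner (s : ℝ) :
    ∫ t in (0:ℝ)..(2 * π), log (6 - 2 * cos s - 2 * cos t - 2 * cos (s - t)) =
      2 * π * log (triaxialRoot (cos (s / 2))) := by
  set c := cos (s / 2) with hc
  have hc1 : c ^ 2 ≤ 1 := cos_sq_le_one _
  set q := triaxialRoot c with hq
  have hq2 : 2 ≤ q := two_le_triaxialRoot hc1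
  have hq0 : q ≠ 0 := by positivity
  have hquad : q ^ 2 + 4 * c ^ 2 = (8 - 4 * c ^ 2) * q := triaxialRoot_quadratic hc1
  set a : ℂ := circleMap 0 (2 * c / q) (s / 2) with ha
  have ha1 : ‖a‖ ≤ 1 := by
    rw [ha, norm_circleMap_zero, abs_div, abs_mul, abs_two, abs_of_pos (by linarith : 0 < q),
      div_le_one (by linarith)]
    have : |c| ≤ 1 := abs_cos_le_one _
    linarith
  have havg : circleAverage (log ‖· - a‖) 0 1 = 0 := by
    rw [circleAverage_log_norm_sub_const_eq_posLog, posLog_eq_zero_iff]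
    simpa using ha1
  have hintegral : ∫ t in (0:ℝ)..(2 * π), log ‖circleMap 0 1 t - a‖ = 0 := by
    rw [circleAverage_def, smul_eq_mul] at havg
    exact (mul_eq_zero.mp havg).resolve_left (by positivity)
  have hii : IntervalIntegrable (fun t ↦ log ‖circleMap 0 1 t - a‖)
      MeasureTheory.volume 0 (2 * π) :=
    circleIntegrable_log_norm_sub_const 1
  have hnorm (t : ℝ) : ‖circleMap 0 1 t - a‖ ^ 2 =
      1 + (2 * c / q) ^ 2 - 2 * (2 * c / q) * cos (t - s / 2) := by
    rw [ha, ← Complex.normSq_eq_norm_sq, Complex.normSq_apply, cos_sub]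
    simp only [circleMap, Complex.sub_re, Complex.sub_im, Complex.add_re, Complex.add_im,
      Complex.re_ofReal_mul, Complex.im_ofReal_mul, Complex.exp_ofReal_mul_I_re,
      Complex.exp_ofReal_mul_I_im, Complex.zero_re, Complex.zero_im]
    linear_combination sin_sq_add_cos_sq t + (2 * c / q) ^ 2 * sin_sq_add_cos_sq (s / 2)
  have hfac (t : ℝ) : 6 - 2 * cos s - 2 * cos t - 2 * cos (s - t) =
      q * ‖circleMap 0 1 t - a‖ ^ 2 := by
    have hcs : cos s = 2 * c ^ 2 - 1 := by rw [hc, ← cos_two_mul]; ring_nf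
    have hct : cos t + cos (s - t) = 2 * c * cos (t - s / 2) := by
      rw [cos_add_cos, hc, show (t + (s - t)) / 2 = s / 2 by ring,
        show (t - (s - t)) / 2 = t - s / 2 by ring]
    rw [hnorm]
    generalize cos (t - s / 2) = x at hct
    field_simp
    linear_combination -hquad - 2 * q * hcs - 2 * q * hct
  have hae : ∫ t in (0:ℝ)..(2 * π), log (6 - 2 * cos s - 2 * cos t - 2 * cos (s - t)) =
      ∫ t in (0:ℝ)..(2 * π), (log q + 2 * log ‖circleMap 0 1 t - a‖) := by
    apply intervalIntegral.integral_congr_codiscreteWithin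
    apply Filter.codiscreteWithin_mono (Set.subset_univ _)
    have han : AnalyticOnNhd ℝ
        (fun t ↦ 1 + (2 * c / q) ^ 2 - 2 * (2 * c / q) * cos (t - s / 2)) Set.univ :=
      fun t _ ↦ by fun_prop
    have hzero := han.preimage_zero_mem_codiscrete (x := s / 2 + π / 2) (by
      simp only [add_sub_cancel_left, cos_pi_div_two, mul_zero, sub_zero]
      positivity)
    filter_upwards [hzero] with t ht
    have hne : ‖circleMap 0 1 t - a‖ ^ 2 ≠ 0 := by
      rw [hnorm]
      exact ht
    rw [hfac, log_mul hq0 hne, log_pow]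
    norm_num
  rw [hae, intervalIntegral.integral_add intervalIntegrable_const (hii.const_mul 2),
    intervalIntegral.integral_const_mul, hintegral]
  simp

/-- The angle `σ` with `tan σ = tan τ / 3`. -/
noncomputable def thirdTanAngle (τ : ℝ) : ℝ := arctan (tan τ / 3)

lemma three_mul_cos_mul_sin_thirdTanAngle {τ : ℝ} (h : cos τ ≠ 0) :
    3 * cos τ * sin (thirdTanAngle τ) = sin τ * cos (thirdTanAngle τ) := by
  have h1 : tan (thirdTanAngle τ) = tan τ / 3 := tan_arctan _
  have h2 : cos (thirdTanAngle τ) ≠ 0 := (cos_arctan_pos _).ne'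
  rw [tan_eq_sin_div_cos, tan_eq_sin_div_cos] at h1
  field_simp at h1
  linarith

lemma hasDerivAt_thirdTanAngle {τ : ℝ} (h : cos τ ≠ 0) :
    HasDerivAt thirdTanAngle (3 / (1 + 8 * cos τ ^ 2)) τ := by
  have := ((hasDerivAt_tan h).div_const 3).arctan
  refine this.congr_deriv ?_
  have hp : 0 < 1 + 8 * cos τ ^ 2 := by positivity
  have hp' : 0 < 1 + (tan τ / 3) ^ 2 := by positivity
  rw [div_mul_div_comm, div_eq_div_iff (by positivity) (by positivity), tan_eq_sin_div_cos]
  field_simp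
  rw [sin_sq]
  ring

lemma sin_thirdTanAngle_sq {τ : ℝ} (h : cos τ ≠ 0) :
    (1 + 8 * cos τ ^ 2) * sin (thirdTanAngle τ) ^ 2 = sin τ ^ 2 := by
  have h1 := three_mul_cos_mul_sin_thirdTanAngle h
  have h2 := sin_sq_add_cos_sq (thirdTanAngle τ)
  have h3 := sin_sq_add_cos_sq τ
  linear_combination (3 * cos τ * sin (thirdTanAngle τ) + sin τ * cos (thirdTanAngle τ)) * h1
    - sin (thirdTanAngle τ) ^ 2 * h3 + sin τ ^ 2 * h2

lemma sin_add_thirdTanAngle {τ : ℝ} (h : cos τ ≠ 0) :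
    sin (τ + thirdTanAngle τ) = 4 * cos τ * sin (thirdTanAngle τ) := by
  rw [sin_add]; linear_combination -three_mul_cos_mul_sin_thirdTanAngle h

lemma sin_sub_thirdTanAngle {τ : ℝ} (h : cos τ ≠ 0) :
    sin (τ - thirdTanAngle τ) = 2 * cos τ * sin (thirdTanAngle τ) := by
  rw [sin_sub]; linear_combination -three_mul_cos_mul_sin_thirdTanAngle h

lemma half_le_cos {τ : ℝ} (h : τ ∈ Set.Icc 0 (π / 3)) : 1 / 2 ≤ cos τ := by
  rw [← cos_pi_div_three]
  exact cos_le_cos_of_nonneg_of_le_pi h.1 (by linarith [pi_pos]) h.2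

lemma triaxialRoot_sin_add_thirdTanAngle {τ : ℝ} (h : 1 / 2 ≤ cos τ) :
    triaxialRoot (sin (τ + thirdTanAngle τ)) = 8 * cos τ ^ 2 := by
  have h0 : cos τ ≠ 0 := by positivity
  have hp : 0 < 1 + 8 * cos τ ^ 2 := by positivity
  have hs := sin_thirdTanAngle_sq h0
  have hs' : sin (thirdTanAngle τ) ^ 2 = (1 - cos τ ^ 2) / (1 + 8 * cos τ ^ 2) := by
    rw [eq_div_iff hp.ne', ← sin_sq]; linarith
  rw [sin_add_thirdTanAngle h0]
  apply triaxialRoot_eq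
  · rw [mul_pow (4 * cos τ), hs']
    field_simp
    ring
  · rw [mul_pow, hs', ← sub_nonneg]
    have : 8 * cos τ ^ 2 - (4 - 2 * ((4 * cos τ) ^ 2 * ((1 - cos τ ^ 2) / (1 + 8 * cos τ ^ 2)))) =
        4 * (4 * cos τ ^ 2 - 1) * (2 * cos τ ^ 2 + 1) / (1 + 8 * cos τ ^ 2) := by
      field_simp
      ring
    rw [this]
    have : 0 ≤ 4 * cos τ ^ 2 - 1 := by nlinarith
    positivity

lemma thirdTanAngle_zero : thirdTanAngle 0 = 0 := by simp [thirdTanAngle]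

lemma thirdTanAngle_pi_div_three : thirdTanAngle (π / 3) = π / 6 := by
  have h : √3 / 3 = tan (π / 6) := by
    rw [tan_pi_div_six]
    field_simp
    norm_num
  rw [thirdTanAngle, tan_pi_div_three, h, arctan_tan] <;> linarith [pi_pos]

lemma continuous_log_triaxialRoot_sin : Continuous fun θ ↦ log (triaxialRoot (sin θ)) :=
  (continuous_triaxialRoot.comp continuous_sin).log fun θ ↦
    (two_pos.trans_le (two_le_triaxialRoot (sin_sq_le_one θ))).ne'

lemma hasDerivAt_lobachevsky_primitive {τ : ℝ} (hτ : τ ∈ Set.Ioo 0 (π / 3)) :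
    HasDerivAt (fun τ ↦ 2 * lobachevsky (thirdTanAngle τ) + lobachevsky (τ - thirdTanAngle τ)
        - lobachevsky (τ + thirdTanAngle τ) - 2 * lobachevsky (τ + π / 2))
      (log (8 * cos τ ^ 2) * (1 + 3 / (1 + 8 * cos τ ^ 2))) τ := by
  have hc : 1 / 2 ≤ cos τ := half_le_cos ⟨hτ.1.le, hτ.2.le⟩
  have hc0 : 0 < cos τ := by linarith
  have htan : 0 < tan τ := tan_pos_of_pos_of_lt_pi_div_two hτ.1 (by linarith [hτ.2, pi_pos])
  have hσ0 : 0 < thirdTanAngle τ := arctan_pos.mpr (by positivity)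
  have hσ1 : thirdTanAngle τ < π / 2 := arctan_lt_pi_div_two _
  have hs : 0 < sin (thirdTanAngle τ) := sin_pos_of_pos_of_lt_pi hσ0 (by linarith [pi_pos])
  have hadd := sin_add_thirdTanAngle hc0.ne'
  have hsub := sin_sub_thirdTanAngle hc0.ne'
  have hd := hasDerivAt_thirdTanAngle hc0.ne'
  have hid := hasDerivAt_id τ
  have d1 := (hasDerivAt_lobachevsky hs.ne').comp τ hd
  have d2 := (hasDerivAt_lobachevsky (θ := τ - thirdTanAngle τ)
    (by rw [hsub]; positivity)).comp τ (hid.sub hd)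
  have d3 := (hasDerivAt_lobachevsky (θ := τ + thirdTanAngle τ)
    (by rw [hadd]; positivity)).comp τ (hid.add hd)
  have d4 := (hasDerivAt_lobachevsky (θ := τ + π / 2)
    (by rw [sin_add_pi_div_two]; positivity)).comp τ (hid.add_const (π / 2))
  refine ((((d1.const_mul 2).add d2).sub d3).sub (d4.const_mul 2)).congr_deriv ?_
  rw [hadd, hsub, sin_add_pi_div_two]
  have e1 : log |2 * sin (thirdTanAngle τ)| = log 2 + log (sin (thirdTanAngle τ)) := by
    rw [log_abs, log_mul (by norm_num) hs.ne']
  have e2 : log |2 * (2 * cos τ * sin (thirdTanAngle τ))| =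
      2 * log 2 + log (cos τ) + log (sin (thirdTanAngle τ)) := by
    rw [log_abs, log_mul (by norm_num) (by positivity), log_mul (by positivity) hs.ne',
      log_mul (by norm_num) hc0.ne']
    ring
  have e3 : log |2 * (4 * cos τ * sin (thirdTanAngle τ))| =
      3 * log 2 + log (cos τ) + log (sin (thirdTanAngle τ)) := by
    rw [show 2 * (4 * cos τ * sin (thirdTanAngle τ)) =
        2 ^ 3 * (cos τ * sin (thirdTanAngle τ)) by ring, log_abs,
      log_mul (by norm_num) (by positivity), log_mul hc0.ne' hs.ne', log_pow]
    push_cast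
    ring
  have e4 : log |2 * cos τ| = log 2 + log (cos τ) := by
    rw [log_abs, log_mul (by norm_num) hc0.ne']
  have e5 : log (8 * cos τ ^ 2) = 3 * log 2 + 2 * log (cos τ) := by
    rw [show (8 : ℝ) = 2 ^ 3 by norm_num, log_mul (by norm_num) (by positivity), log_pow, log_pow]
    push_cast
    ring
  rw [e1, e2, e3, e4, e5]
  ring

lemma integral_log_triaxialRoot_sin :
    ∫ θ in (0:ℝ)..(π / 2), log (triaxialRoot (sin θ)) = 15 / 2 * lobachevsky (π / 3) := by
  have hIcc : Set.uIcc 0 (π / 3) = Set.Icc 0 (π / 3) := Set.uIcc_of_le (by positivity)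
  have hcos0 : ∀ τ ∈ Set.Icc 0 (π / 3), cos τ ≠ 0 := fun τ hτ ↦ by
    have := half_le_cos hτ
    positivity
  have hderiv : Continuous fun τ ↦ 1 + 3 / (1 + 8 * cos τ ^ 2) :=
    continuous_const.add (continuous_const.div (by fun_prop) fun τ ↦ by positivity)
  have hσ : ContinuousOn thirdTanAngle (Set.Icc 0 (π / 3)) := fun τ hτ ↦
    (hasDerivAt_thirdTanAngle (hcos0 τ hτ)).continuousAt.continuousWithinAt
  have hsubst := intervalIntegral.integral_comp_mul_deriv (a := 0) (b := π / 3)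
    (f := fun τ ↦ τ + thirdTanAngle τ) (f' := fun τ ↦ 1 + 3 / (1 + 8 * cos τ ^ 2))
    (g := fun θ ↦ log (triaxialRoot (sin θ)))
    (fun τ hτ ↦ (hasDerivAt_id τ).add (hasDerivAt_thirdTanAngle (hcos0 τ (hIcc ▸ hτ))))
    hderiv.continuousOn continuous_log_triaxialRoot_sin
  rw [thirdTanAngle_zero, thirdTanAngle_pi_div_three, add_zero,
    show π / 3 + π / 6 = π / 2 by ring] at hsubst
  rw [← hsubst]
  have hcongr : ∫ τ in (0:ℝ)..(π / 3),
      ((fun θ ↦ log (triaxialRoot (sin θ))) ∘ fun τ ↦ τ + thirdTanAngle τ) τ *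
        (1 + 3 / (1 + 8 * cos τ ^ 2)) =
      ∫ τ in (0:ℝ)..(π / 3), log (8 * cos τ ^ 2) * (1 + 3 / (1 + 8 * cos τ ^ 2)) := by
    refine intervalIntegral.integral_congr fun τ hτ ↦ ?_
    simp only [Function.comp_apply]
    rw [triaxialRoot_sin_add_thirdTanAngle (half_le_cos (hIcc ▸ hτ))]
  have hcontΛ := continuous_lobachevsky
  rw [hcongr, intervalIntegral.integral_eq_sub_of_hasDerivAt_of_le (by positivity) (by fun_prop)
    (fun τ hτ ↦ hasDerivAt_lobachevsky_primitive hτ)]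
  · have h56 := lobachevsky_pi_sub (π / 6)
    rw [lobachevsky_pi, lobachevsky_pi_div_six] at h56
    rw [thirdTanAngle_zero, thirdTanAngle_pi_div_three, add_zero, sub_zero, zero_add,
      show π / 3 + π / 6 = π / 2 by ring, show π / 3 - π / 6 = π / 6 by ring,
      show π / 3 + π / 2 = π - π / 6 by ring, h56, lobachevsky_zero, lobachevsky_pi_div_two,
      lobachevsky_pi_div_six]
    ring
  · apply ContinuousOn.intervalIntegrable
    rw [hIcc]
    refine ContinuousOn.mul (ContinuousOn.log (by fun_prop) fun τ hτ ↦ ?_)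
      hderiv.continuousOn
    have := hcos0 τ hτ
    positivity

lemma integral_log_triaxialRoot_cos_half :
    ∫ s in (0:ℝ)..(2 * π), log (triaxialRoot (cos (s / 2))) = 30 * lobachevsky (π / 3) := by
  have hcont : Continuous fun θ ↦ log (triaxialRoot (cos θ)) := by
    have hsub : Continuous fun θ : ℝ ↦ π / 2 - θ := by fun_prop
    simpa only [Function.comp_def, sin_pi_div_two_sub] using
      continuous_log_triaxialRoot_sin.comp hsub
  have hscale := intervalIntegral.integral_comp_div (a := 0) (b := 2 * π)
    (fun θ ↦ log (triaxialRoot (cos θ))) (two_ne_zero (α := ℝ))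
  have hsplit := intervalIntegral.integral_add_adjacent_intervals
    (hcont.intervalIntegrable (μ := MeasureTheory.volume) 0 (π / 2))
    (hcont.intervalIntegrable (π / 2) π)
  have hrefl := intervalIntegral.integral_comp_sub_left (a := 0) (b := π / 2)
    (fun θ ↦ log (triaxialRoot (cos θ))) π
  have hquarter := intervalIntegral.integral_comp_sub_left (a := 0) (b := π / 2)
    (fun θ ↦ log (triaxialRoot (cos θ))) (π / 2)
  simp only [cos_pi_sub, triaxialRoot_neg, sub_zero, sub_half] at hrefl
  simp only [cos_pi_div_two_sub, sub_zero, sub_self, integral_log_triaxialRoot_sin] at hquarter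
  rw [hscale, zero_div, mul_div_cancel_left₀ π two_ne_zero, ← hsplit, ← hrefl, ← hquarter,
    smul_eq_mul]
  ring

/-- For the characteristic polynomial `p(z,w) = 6 − (w + 1/w + z + 1/z + w/z + z/w)`
of the toroidal dimer model for the triaxial link, `2π · m(p) = 10 v_tet`, where
`v_tet = 3Λ(π/3)` and `Λ(θ) = −∫₀^θ log|2 sin u| du`; equivalently
`∫₀^{2π}∫₀^{2π} log(6 − 2 cos s − 2 cos t − 2 cos(s−t)) ds dt = −60π ∫₀^{π/3} log|2 sin u| du`. -/
theorem mahler_triaxial_eq_ten_vtet :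
    (∫ s in (0:ℝ)..(2*π), ∫ t in (0:ℝ)..(2*π),
        Real.log (6 - 2 * Real.cos s - 2 * Real.cos t - 2 * Real.cos (s - t)))
      = -60 * π * ∫ u in (0:ℝ)..(π/3), Real.log |2 * Real.sin u| := by
  simp only [integral_log_triaxial_inner, intervalIntegral.integral_const_mul,
    integral_log_triaxialRoot_cos_half, lobachevsky]
  ring
end
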